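/- arXiv:0905.2753 — 2 statements merged into one kernel-verified Lean document; each statement's English description precedes it below -/
import Mathlib

section
/- For every x ∈ (-1,1), the boundary values of the Szegő function D(z,h) exist and are given by: lim_{z→x, Im z>0} D(z,h) = √(h(x))·exp( -i·(√(1-x²)/(2π))·PV∫_{-1}^1 (log h(t)/√(1-t²))·dt/(t-x) ) and lim_{z→x, Im z<0} D(z,h) = √(h(x))·exp( +i·(√(1-x²)/(2π))·PV∫_{-1}^1 (log h(t)/√(1-t²))·dt/(t-x) ), where PV denotes the Cauchy principal value at t = x. -/
noncomputable section

open Filter Set MeasureTheory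

/-- The segment `[-1,1]` viewed as a subset of `ℂ`. -/
def seg : Set ℂ := {z : ℂ | z.im = 0 ∧ -1 ≤ z.re ∧ z.re ≤ 1}

open scoped Topology

/-- The regularised Cauchy kernel of a function Lipschitz near `x` is dominated, locally uniformly
in `z` near `x`, by an integrable function. -/
lemma exists_cauchyKernel_bound {g : ℝ → ℝ} {a b x : ℝ} {K : NNReal} {N : Set ℝ}
    (hg : IntervalIntegrable g volume a b) (hN : N ∈ 𝓝 x) (hK : LipschitzOnWith K g N) :
    ∃ B : ℝ → ℝ, IntervalIntegrable B volume a b ∧ ∀ᶠ z : ℂ in 𝓝 (x : ℂ), ∀ t : ℝ,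
      ‖((g t : ℂ) - g z.re) / (t - z)‖ ≤ B t := by
  obtain ⟨r, hr, hrN⟩ := Metric.mem_nhds_iff.1 hN
  refine ⟨fun t => K + 2 / r * (|g t| + (|g x| + K * r)), ?_, ?_⟩
  · exact intervalIntegrable_const.add
      ((hg.abs.add intervalIntegrable_const).const_mul _)
  filter_upwards [Metric.ball_mem_nhds (x : ℂ) (half_pos hr)] with z hz t
  have hz' : ‖z - x‖ < r / 2 := by simpa [dist_eq_norm] using hz
  have hre : |z.re - x| < r / 2 := by
    have := Complex.abs_re_le_norm (z - x)
    simp only [Complex.sub_re, Complex.ofReal_re] at this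
    linarith
  have hzN : z.re ∈ N := hrN (by rw [Metric.mem_ball, Real.dist_eq]; linarith)
  have hxN : x ∈ N := mem_of_mem_nhds hN
  have hrest : 0 ≤ 2 / r * (|g t| + (|g x| + K * r)) := by positivity
  rw [norm_div, ← Complex.ofReal_sub, Complex.norm_real, Real.norm_eq_abs]
  rcases lt_or_ge |t - x| r with htx | htx
  · have h1 := hK.dist_le_mul t (hrN (by rwa [Metric.mem_ball, Real.dist_eq])) _ hzN
    rw [Real.dist_eq, Real.dist_eq] at h1
    have h2 : |t - z.re| ≤ ‖(t : ℂ) - z‖ := by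
      simpa using Complex.abs_re_le_norm ((t : ℂ) - z)
    have : |g t - g z.re| / ‖(t : ℂ) - z‖ ≤ K :=
      div_le_of_le_mul₀ (norm_nonneg _) K.coe_nonneg
        (h1.trans (mul_le_mul_of_nonneg_left h2 K.coe_nonneg))
    linarith
  · have h1 := hK.dist_le_mul _ hzN _ hxN
    rw [Real.dist_eq, Real.dist_eq] at h1
    have h2 : r / 2 ≤ ‖(t : ℂ) - z‖ := by
      have := norm_sub_le_norm_sub_add_norm_sub (t : ℂ) z x
      rw [← Complex.ofReal_sub, Complex.norm_real, Real.norm_eq_abs] at this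
      linarith
    have h3 : |g t - g z.re| ≤ |g t| + (|g x| + K * r) := by
      have e1 := abs_sub (g t) (g z.re)
      have e2 := abs_sub_abs_le_abs_sub (g z.re) (g x)
      have e3 : K * |z.re - x| ≤ K * r :=
        mul_le_mul_of_nonneg_left (by linarith) K.coe_nonneg
      linarith
    have : |g t - g z.re| / ‖(t : ℂ) - z‖ ≤ 2 / r * (|g t| + (|g x| + K * r)) := by
      calc |g t - g z.re| / ‖(t : ℂ) - z‖ ≤ (|g t| + (|g x| + K * r)) / (r / 2) := by gcongr
        _ = _ := by field_simp
    have := K.coe_nonneg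
    linarith

lemma intervalIntegrable_cauchyKernel {g : ℝ → ℝ} {a b x : ℝ} {K : NNReal} {N : Set ℝ}
    (hg : IntervalIntegrable g volume a b) (hN : N ∈ 𝓝 x) (hK : LipschitzOnWith K g N) :
    IntervalIntegrable (fun t => (g t - g x) / (t - x)) volume a b := by
  obtain ⟨B, hB, hle⟩ := exists_cauchyKernel_bound hg hN hK
  refine hB.mono_fun ?_ (Eventually.of_forall fun t => ?_)
  · exact (hg.aestronglyMeasurable_restrict_uIoc.sub aestronglyMeasurable_const).div₀
      (by fun_prop)
  · have := hle.self_of_nhds t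
    refine le_trans ?_ (this.trans (le_abs_self _))
    rw [Complex.ofReal_re, ← Complex.ofReal_sub, ← Complex.ofReal_sub, ← Complex.ofReal_div,
      Complex.norm_real]

lemma tendsto_integral_cauchyKernel {g : ℝ → ℝ} {a b x : ℝ} {K : NNReal} {N : Set ℝ}
    (hg : IntervalIntegrable g volume a b) (hN : N ∈ 𝓝 x) (hK : LipschitzOnWith K g N) :
    Tendsto (fun z : ℂ => ∫ t in a..b, ((g t : ℂ) - g z.re) / (t - z)) (𝓝 (x : ℂ))
      (𝓝 ((∫ t in a..b, (g t - g x) / (t - x) : ℝ) : ℂ)) := by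
  obtain ⟨B, hB, hle⟩ := exists_cauchyKernel_bound hg hN hK
  have hgx : ContinuousAt g x := hK.continuousOn.continuousAt hN
  rw [← intervalIntegral.integral_ofReal]
  refine intervalIntegral.tendsto_integral_filter_of_dominated_convergence B ?_ ?_ hB ?_
  · refine Eventually.of_forall fun z => ?_
    exact ((Complex.continuous_ofReal.comp_aestronglyMeasurable
      hg.aestronglyMeasurable_restrict_uIoc).sub aestronglyMeasurable_const).div₀ (by fun_prop)
  · filter_upwards [hle] with z hz
    exact Eventually.of_forall fun t _ => hz t
  · have : ∀ᵐ t : ℝ, t ≠ x := by simp [ae_iff, measure_singleton]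
    filter_upwards [this] with t ht _
    have h0 : (t : ℂ) - (x : ℂ) ≠ 0 := by
      rw [← Complex.ofReal_sub]; exact_mod_cast sub_ne_zero.2 ht
    have h1 : Tendsto (fun z : ℂ => g z.re) (𝓝 (x : ℂ)) (𝓝 (g x)) :=
      hgx.tendsto.comp (Complex.continuous_re.tendsto' _ _ (Complex.ofReal_re x))
    have h2 := ((Complex.continuous_ofReal.tendsto _).comp h1)
    push_cast
    exact (tendsto_const_nhds.sub h2).div (tendsto_const_nhds.sub tendsto_id) h0

lemma tendsto_principalValue {g : ℝ → ℝ} {a b x : ℝ} {K : NNReal} {N : Set ℝ}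
    (hx : x ∈ Ioo a b)
    (hg : IntervalIntegrable g volume a b) (hN : N ∈ 𝓝 x) (hK : LipschitzOnWith K g N) :
    Tendsto (fun ε : ℝ => (∫ t in a..(x - ε), g t / (t - x)) + ∫ t in (x + ε)..b, g t / (t - x))
      (𝓝[>] 0) (𝓝 ((∫ t in a..b, (g t - g x) / (t - x)) +
        g x * (Real.log (b - x) - Real.log (x - a)))) := by
  have hq := intervalIntegrable_cauchyKernel hg hN hK
  obtain ⟨hax, hxb⟩ := hx
  have hab : a ≤ b := (hax.trans hxb).le
  set q : ℝ → ℝ := fun t => (g t - g x) / (t - x) with hqdef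
  have hsub : ∀ {c d : ℝ}, c ∈ Icc a b → d ∈ Icc a b → IntervalIntegrable q volume c d := by
    intro c d hc hd
    refine hq.mono_set ?_
    rw [uIcc_of_le hab]
    exact uIcc_subset_Icc hc hd
  have hsplit : ∀ {c d : ℝ}, c ∈ Icc a b → d ∈ Icc a b → x ∉ uIcc c d →
      ∫ t in c..d, g t / (t - x) =
        (∫ t in c..d, q t) + g x * Real.log ((d - x) / (c - x)) := by
    intro c d hc hd hxn
    have h0 : (0 : ℝ) ∉ uIcc (c - x) (d - x) := by
      intro h
      apply hxn
      rw [mem_uIcc] at h ⊢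
      rcases h with h | h
      · left; constructor <;> linarith [h.1, h.2]
      · right; constructor <;> linarith [h.1, h.2]
    have hne : ∀ t ∈ uIcc c d, t - x ≠ 0 := fun t ht h => hxn (by rwa [← sub_eq_zero.1 h])
    have hinv : IntervalIntegrable (fun t => (t - x)⁻¹) volume c d :=
      ContinuousOn.intervalIntegrable (ContinuousOn.inv₀ (by fun_prop) hne)
    rw [← integral_inv h0, ← intervalIntegral.integral_comp_sub_right (fun t => t⁻¹) x,
      ← intervalIntegral.integral_const_mul,
      ← intervalIntegral.integral_add (hsub hc hd) (hinv.const_mul _)]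
    refine intervalIntegral.integral_congr fun t ht => ?_
    have := hne t ht
    simp only [hqdef]
    field_simp
    ring
  have hcont : ContinuousOn (fun u => ∫ t in a..u, q t) (Icc a b) := by
    have := intervalIntegral.continuousOn_primitive_interval' hq left_mem_uIcc
    rwa [uIcc_of_le hab] at this
  have hcx : ContinuousAt (fun u => ∫ t in a..u, q t) x :=
    hcont.continuousAt (Icc_mem_nhds hax hxb)
  have hl : Tendsto (fun ε : ℝ => ∫ t in a..(x - ε), q t) (𝓝[>] 0) (𝓝 (∫ t in a..x, q t)) := by
    refine hcx.tendsto.comp (tendsto_nhdsWithin_of_tendsto_nhds ?_)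
    exact Continuous.tendsto' (by fun_prop) _ _ (by simp)
  have hr : Tendsto (fun ε : ℝ => ∫ t in a..(x + ε), q t) (𝓝[>] 0) (𝓝 (∫ t in a..x, q t)) := by
    refine hcx.tendsto.comp (tendsto_nhdsWithin_of_tendsto_nhds ?_)
    exact Continuous.tendsto' (by fun_prop) _ _ (by simp)
  have hlim := (hl.add (tendsto_const_nhds (x := ∫ t in a..b, q t) |>.sub hr)).add_const
    (g x * (Real.log (b - x) - Real.log (x - a)))
  rw [add_sub_cancel] at hlim
  refine hlim.congr' ?_
  filter_upwards [Ioo_mem_nhdsGT (lt_min (sub_pos.2 hax) (sub_pos.2 hxb))] with ε hε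
  obtain ⟨hε0, hε1⟩ := hε
  have hεa : ε < x - a := hε1.trans_le (min_le_left _ _)
  have hεb : ε < b - x := hε1.trans_le (min_le_right _ _)
  have ha : a ∈ Icc a b := left_mem_Icc.2 hab
  have hb : b ∈ Icc a b := right_mem_Icc.2 hab
  have hm1 : x - ε ∈ Icc a b := ⟨by linarith, by linarith⟩
  have hm2 : x + ε ∈ Icc a b := ⟨by linarith, by linarith⟩
  rw [hsplit ha hm1 (notMem_uIcc_of_gt hax (by linarith)),
    hsplit hm2 hb (notMem_uIcc_of_lt (by linarith) hxb),
    ← intervalIntegral.integral_interval_sub_left (hsub ha hb) (hsub ha hm2)]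
  have e1 : Real.log ((x - ε - x) / (a - x)) = Real.log ε - Real.log (x - a) := by
    rw [← Real.log_div hε0.ne' (sub_pos.2 hax).ne', ← neg_sub x a, sub_sub_cancel_left,
      neg_div_neg_eq]
  have e2 : Real.log ((b - x) / (x + ε - x)) = Real.log (b - x) - Real.log ε := by
    rw [add_sub_cancel_left, Real.log_div (sub_pos.2 hxb).ne' hε0.ne']
  rw [e1, e2]
  ring

lemma integral_inv_ofReal_sub {a b : ℝ} {z : ℂ} (hz : z.im ≠ 0) :
    ∫ t in a..b, ((t : ℂ) - z)⁻¹ = Complex.log (b - z) - Complex.log (a - z) := by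
  have hsl : ∀ t : ℝ, (t : ℂ) - z ∈ Complex.slitPlane := fun t => by
    right; simpa using hz
  refine intervalIntegral.integral_eq_sub_of_hasDerivAt
    (f := fun t : ℝ => Complex.log ((t : ℂ) - z)) (fun t _ => ?_) ?_
  · have := (((hasDerivAt_id (t : ℂ)).sub_const z).clog (hsl t)).comp_ofReal
    simpa using this
  · exact (Continuous.inv₀ (by fun_prop)
      fun t => Complex.slitPlane_ne_zero (hsl t)).intervalIntegrable _ _

/-- Both Sokhotski–Plemelj formulas, given the boundary value of `log (a - z)`. -/
lemma tendsto_cauchyIntegral {g : ℝ → ℝ} {a b x : ℝ} {K : NNReal} {N : Set ℝ}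
    {H : Set ℂ} {L : ℂ} (hx : x ∈ Ioo a b)
    (hg : IntervalIntegrable g volume a b) (hN : N ∈ 𝓝 x) (hK : LipschitzOnWith K g N)
    (hH : ∀ z ∈ H, z.im ≠ 0)
    (hL : Tendsto (fun z : ℂ => Complex.log (a - z)) (𝓝[H] (x : ℂ)) (𝓝 L)) :
    Tendsto (fun z : ℂ => ∫ t in a..b, (g t : ℂ) / (t - z)) (𝓝[H] (x : ℂ))
      (𝓝 (((∫ t in a..b, (g t - g x) / (t - x) : ℝ) : ℂ) +
        g x * (Real.log (b - x) - L))) := by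
  have hgx : ContinuousAt g x := hK.continuousOn.continuousAt hN
  have h1 : Tendsto (fun z : ℂ => (g z.re : ℂ)) (𝓝[H] (x : ℂ)) (𝓝 (g x)) :=
    tendsto_nhdsWithin_of_tendsto_nhds <| (Complex.continuous_ofReal.tendsto _).comp <|
      hgx.tendsto.comp (Complex.continuous_re.tendsto' _ _ (Complex.ofReal_re x))
  have h2 : Tendsto (fun z : ℂ => Complex.log (b - z)) (𝓝[H] (x : ℂ)) (𝓝 (Real.log (b - x))) := by
    refine tendsto_nhdsWithin_of_tendsto_nhds ?_
    rw [Complex.ofReal_log (sub_pos.2 hx.2).le, Complex.ofReal_sub]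
    refine (tendsto_const_nhds.sub tendsto_id).clog (Or.inl ?_)
    simpa using hx.2
  refine Tendsto.congr' ?_
    ((tendsto_nhdsWithin_of_tendsto_nhds (tendsto_integral_cauchyKernel hg hN hK)).add
      (h1.mul (h2.sub hL)))
  filter_upwards [self_mem_nhdsWithin] with z hz
  have hne : ∀ t : ℝ, (t : ℂ) - z ≠ 0 := fun t h => hH z hz (by simpa using congrArg Complex.im h)
  have hinv : Continuous fun t : ℝ => ((t : ℂ) - z)⁻¹ := Continuous.inv₀ (by fun_prop) hne
  have hgc : IntervalIntegrable (fun t => (g t : ℂ) - g z.re) volume a b :=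
    IntervalIntegrable.sub ⟨hg.1.ofReal, hg.2.ofReal⟩ intervalIntegrable_const
  rw [← integral_inv_ofReal_sub (hH z hz), ← intervalIntegral.integral_const_mul,
    ← intervalIntegral.integral_add]
  · congr 1 with t
    rw [div_eq_mul_inv, div_eq_mul_inv]
    ring
  · simp_rw [div_eq_mul_inv]
    exact hgc.mul_continuousOn hinv.continuousOn
  · exact (hinv.intervalIntegrable _ _).const_mul _

lemma one_sub_sq_mem_slitPlane {z : ℂ} (hz : z.im ≠ 0) : 1 - z ^ 2 ∈ Complex.slitPlane := by
  rw [Complex.mem_slitPlane_iff]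
  by_cases h : z.re = 0
  · left
    have : 0 < z.im ^ 2 := by positivity
    simp [pow_two, h]
    nlinarith
  · right
    simp [pow_two]
    intro h'
    apply h
    have : z.re * z.im = 0 := by linarith
    simpa [hz] using this

/-- On a half plane, a square root of `z² - 1` asymptotic to `z` along `± i ∞` is
`± i √(1 - z²)` with the principal square root. -/
lemma eqOn_sqrt_halfPlane {s : ℂ → ℂ} {H : Set ℂ} {σ : ℝ} (hσ : σ = 1 ∨ σ = -1)
    (hHc : IsPreconnected H) (hH : ∀ z ∈ H, z.im ≠ 0)
    (hHi : ∀ y : ℝ, 0 < y → (σ * y : ℝ) * Complex.I ∈ H)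
    (hs : ContinuousOn s H) (hs2 : ∀ z ∈ H, s z ^ 2 = z ^ 2 - 1)
    (hsinf : Tendsto (fun z => s z / z) (Bornology.cobounded ℂ) (𝓝 1)) :
    ∀ z ∈ H, s z = σ * Complex.I * (1 - z ^ 2) ^ (1 / 2 : ℂ) := by
  have hroot : ∀ w : ℂ, (w ^ (1 / 2 : ℂ)) ^ 2 = w := fun w => by
    rw [one_div]; exact_mod_cast Complex.cpow_nat_inv_pow w two_ne_zero
  have hσ2 : (σ : ℂ) ^ 2 = 1 := by rcases hσ with rfl | rfl <;> norm_num
  set r : ℂ → ℂ := fun z => σ * Complex.I * (1 - z ^ 2) ^ (1 / 2 : ℂ) with hr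
  have hr2 : ∀ z, r z ^ 2 = z ^ 2 - 1 := fun z => by
    simp only [hr, mul_pow, hσ2, Complex.I_sq, hroot]; ring
  have hrc : ContinuousOn r H := by
    refine continuousOn_const.mul (ContinuousOn.cpow_const (by fun_prop) ?_)
    exact fun z hz => one_sub_sq_mem_slitPlane (hH z hz)
  have hr0 : ∀ {z : ℂ}, z ∈ H → r z ≠ 0 := fun {z} hz h => by
    have h1 := hr2 z
    rw [h] at h1
    exact Complex.slitPlane_ne_zero (one_sub_sq_mem_slitPlane (hH z hz))
      (by linear_combination h1)
  rcases hHc.eq_or_eq_neg_of_sq_eq hs hrc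
    (fun z hz => by simp only [Pi.pow_apply, hr2, hs2 z hz]) hr0 with h | h
  · exact h
  exfalso
  have htend : Tendsto (fun y : ℝ => ((σ * y : ℝ) : ℂ) * Complex.I) atTop
      (Bornology.cobounded ℂ) := by
    rw [← tendsto_norm_atTop_iff_cobounded]
    refine tendsto_abs_atTop_atTop.congr fun y => ?_
    rcases hσ with rfl | rfl <;> simp
  have hlim := (Complex.continuous_re.tendsto _).comp (hsinf.comp htend)
  have hle : ∀ᶠ y : ℝ in atTop, (s ((σ * y : ℝ) * Complex.I) / ((σ * y : ℝ) * Complex.I)).re ≤ 0 := by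
    filter_upwards [eventually_gt_atTop 0] with y hy
    rw [h (hHi y hy)]
    have e : (1 : ℂ) - ((σ * y : ℝ) * Complex.I) ^ 2 = ((1 + y ^ 2 : ℝ) : ℂ) := by
      rw [mul_pow, Complex.I_sq]; push_cast; rw [mul_pow, hσ2]; ring
    have e2 : ((1 + y ^ 2 : ℝ) : ℂ) ^ (1 / 2 : ℂ) = ((Real.sqrt (1 + y ^ 2) : ℝ) : ℂ) := by
      rw [Real.sqrt_eq_rpow, Complex.ofReal_cpow (by positivity)]; norm_num
    have hσ0 : (σ : ℂ) ≠ 0 := by rintro h0; simp [h0] at hσ2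
    have : (-r) ((σ * y : ℝ) * Complex.I) / ((σ * y : ℝ) * Complex.I) =
        ((-(Real.sqrt (1 + y ^ 2) / y) : ℝ) : ℂ) := by
      simp only [Pi.neg_apply, hr]
      rw [e, e2]
      push_cast
      have : (y : ℂ) ≠ 0 := by exact_mod_cast hy.ne'
      field_simp
    rw [this, Complex.ofReal_re]
    have : 0 ≤ Real.sqrt (1 + y ^ 2) / y := by positivity
    linarith
  have := le_of_tendsto hlim hle
  simp at this
  linarith

lemma tendsto_sqrt_halfPlane {s : ℂ → ℂ} {H : Set ℂ} {σ x : ℝ} (hx : x ∈ Ioo (-1 : ℝ) 1)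
    (h : ∀ z ∈ H, s z = σ * Complex.I * (1 - z ^ 2) ^ (1 / 2 : ℂ)) :
    Tendsto (fun z => -Complex.I * s z) (𝓝[H] (x : ℂ)) (𝓝 (σ * Real.sqrt (1 - x ^ 2))) := by
  have hpos : 0 < 1 - x ^ 2 := by nlinarith [hx.1, hx.2]
  have e : (1 : ℂ) - (x : ℂ) ^ 2 = ((1 - x ^ 2 : ℝ) : ℂ) := by push_cast; ring
  have hc : ContinuousAt (fun z : ℂ => (σ : ℂ) * (1 - z ^ 2) ^ (1 / 2 : ℂ)) (x : ℂ) := by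
    refine continuousAt_const.mul (ContinuousAt.cpow (by fun_prop) continuousAt_const ?_)
    rw [e]
    exact Complex.ofReal_mem_slitPlane.2 hpos
  have e2 : (σ : ℂ) * Real.sqrt (1 - x ^ 2) = σ * (1 - (x : ℂ) ^ 2) ^ (1 / 2 : ℂ) := by
    rw [e, Real.sqrt_eq_rpow, Complex.ofReal_cpow hpos.le]; norm_num
  rw [e2]
  refine (tendsto_nhdsWithin_of_tendsto_nhds hc.tendsto).congr' ?_
  filter_upwards [self_mem_nhdsWithin] with z hz
  rw [h z hz]
  linear_combination ((σ : ℂ) * (1 - z ^ 2) ^ (1 / 2 : ℂ)) * Complex.I_sq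

lemma tendsto_log_neg_one_sub {x σ : ℝ} (hx : -1 < x) (hσ : σ = 1 ∨ σ = -1) :
    Tendsto (fun z : ℂ => Complex.log (((-1 : ℝ) : ℂ) - z)) (𝓝[{z : ℂ | 0 < σ * z.im}] (x : ℂ))
      (𝓝 (Real.log (x - -1) - σ * (Real.pi * Complex.I))) := by
  have hre : (((-1 : ℝ) : ℂ) - x).re < 0 := by simp; linarith
  have him : (((-1 : ℝ) : ℂ) - x).im = 0 := by simp
  have hnorm : ‖((-1 : ℝ) : ℂ) - x‖ = x - -1 := by
    rw [← Complex.ofReal_sub, Complex.norm_real, Real.norm_eq_abs, abs_of_neg (by linarith)]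
    ring
  have hc : Tendsto (fun z : ℂ => ((-1 : ℝ) : ℂ) - z) (𝓝[{z : ℂ | 0 < σ * z.im}] (x : ℂ))
      (𝓝 (((-1 : ℝ) : ℂ) - x)) :=
    tendsto_nhdsWithin_of_tendsto_nhds (Continuous.tendsto (by fun_prop) _)
  rcases hσ with rfl | rfl
  · have := (Complex.tendsto_log_nhdsWithin_im_neg_of_re_neg_of_im_zero hre him).comp
      (tendsto_nhdsWithin_iff.2 ⟨hc, by
        filter_upwards [self_mem_nhdsWithin] with z hz
        simpa using hz⟩)
    rw [hnorm] at this
    simpa [Function.comp_def] using this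
  · have := (Complex.tendsto_log_nhdsWithin_im_nonneg_of_re_neg_of_im_zero hre him).comp
      (tendsto_nhdsWithin_iff.2 ⟨hc, by
        filter_upwards [self_mem_nhdsWithin] with z hz
        have : 0 < -1 * z.im := hz
        simp
        linarith⟩)
    rw [hnorm] at this
    simpa [Function.comp_def] using this

/-- The Chebyshev-weighted logarithm of a positive holomorphic function is integrable. -/
lemma intervalIntegrable_log_div_sqrt {h : ℂ → ℂ} {U : Set ℂ} (hseg : seg ⊆ U)
    (hhol : DifferentiableOn ℂ h U)
    (hpos : ∀ x ∈ Icc (-1 : ℝ) 1, (h x).im = 0 ∧ 0 < (h x).re) :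
    IntervalIntegrable (fun t : ℝ => Real.log (h t).re / Real.sqrt (1 - t ^ 2)) volume (-1) 1 := by
  have hIcc : uIcc (-1 : ℝ) 1 = Icc (-1) 1 := uIcc_of_le (by norm_num)
  have hc : ContinuousOn (fun t : ℝ => Real.log (h t).re) (uIcc (-1) 1) := by
    rw [hIcc]
    refine ContinuousOn.log ?_ fun t ht => (hpos t ht).2.ne'
    refine Complex.continuous_re.comp_continuousOn (hhol.continuousOn.comp
      Complex.continuous_ofReal.continuousOn fun t ht => hseg ?_)
    exact ⟨Complex.ofReal_im t, by simpa using ht.1, by simpa using ht.2⟩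
  simp_rw [div_eq_mul_inv]
  refine IntervalIntegrable.continuousOn_mul ?_ hc
  simpa using Polynomial.Chebyshev.intervalIntegrable_sqrt_one_sub_sq_inv

lemma contDiffAt_log_div_sqrt {h : ℂ → ℂ} {U : Set ℂ} (hU : IsOpen U)
    (hhol : DifferentiableOn ℂ h U) {x : ℝ} (hx : x ∈ Ioo (-1 : ℝ) 1) (hxU : (x : ℂ) ∈ U)
    (hpos : 0 < (h x).re) :
    ContDiffAt ℝ 1 (fun t : ℝ => Real.log (h t).re / Real.sqrt (1 - t ^ 2)) x := by
  have hw : 0 < 1 - x ^ 2 := by nlinarith [hx.1, hx.2]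
  have hh : ContDiffAt ℝ 1 (fun t : ℝ => (h t).re) x :=
    (hhol.analyticAt (hU.mem_nhds hxU)).contDiffAt.real_of_complex
  exact (hh.log hpos.ne').div ((by fun_prop : ContDiffAt ℝ 1 (fun t : ℝ => 1 - t ^ 2) x).sqrt hw.ne')
    (Real.sqrt_pos.2 hw).ne'

/-- The boundary value on the side of `[-1, 1]` determined by the sign `σ`. -/
lemma tendsto_szego_side {g : ℝ → ℝ} {s D : ℂ → ℂ} {x σ p : ℝ} {K : NNReal} {N : Set ℝ}
    (hx : x ∈ Ioo (-1 : ℝ) 1) (hσ : σ = 1 ∨ σ = -1)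
    (hg : IntervalIntegrable g volume (-1) 1) (hN : N ∈ 𝓝 x) (hK : LipschitzOnWith K g N)
    (hp : 0 < p) (hgp : Real.sqrt (1 - x ^ 2) * g x = Real.log p)
    (hs : DifferentiableOn ℂ s segᶜ) (hs2 : ∀ z ∉ seg, s z ^ 2 = z ^ 2 - 1)
    (hsinf : Tendsto (fun z => s z / z) (Bornology.cobounded ℂ) (𝓝 1))
    (hD : ∀ z ∉ seg, D z = Complex.exp ((-Complex.I * s z) *
        ((1 / (2 * (Real.pi : ℂ) * Complex.I)) * ∫ t in (-1 : ℝ)..1, (g t : ℂ) / ((t : ℂ) - z)))) :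
    Tendsto D (𝓝[{z : ℂ | 0 < σ * z.im}] (x : ℂ))
      (𝓝 ((Real.sqrt p : ℂ) * Complex.exp (-(σ * Complex.I) *
        ((Real.sqrt (1 - x ^ 2) / (2 * Real.pi) * ((∫ t in (-1 : ℝ)..1, (g t - g x) / (t - x)) +
          g x * (Real.log (1 - x) - Real.log (x - -1))) : ℝ) : ℂ)))) := by
  set H : Set ℂ := {z : ℂ | 0 < σ * z.im} with hHdef
  have hH : ∀ z ∈ H, z.im ≠ 0 := fun z hz h0 => by
    have : 0 < σ * z.im := hz
    simp [h0] at this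
  have hHseg : ∀ z ∈ H, z ∉ seg := fun z hz h => hH z hz h.1
  have hσ1 : σ * σ = 1 := by rcases hσ with rfl | rfl <;> norm_num
  have hσ2 : (σ : ℂ) ^ 2 = 1 := by rw [pow_two]; exact_mod_cast hσ1
  have hHc : IsPreconnected H := by
    rcases hσ with rfl | rfl
    · simpa [hHdef] using (convex_halfSpace_im_gt 0).isPreconnected
    · simpa [hHdef] using (convex_halfSpace_im_lt 0).isPreconnected
  have hHi : ∀ y : ℝ, 0 < y → ((σ * y : ℝ) : ℂ) * Complex.I ∈ H := fun y hy => by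
    change 0 < σ * (((σ * y : ℝ) : ℂ) * Complex.I).im
    rw [Complex.im_ofReal_mul, Complex.I_im, mul_one, ← mul_assoc, hσ1, one_mul]
    exact hy
  have hsH := eqOn_sqrt_halfPlane hσ hHc hH hHi (hs.continuousOn.mono hHseg)
    (fun z hz => hs2 z (hHseg z hz)) hsinf
  have hlim := (tendsto_sqrt_halfPlane hx hsH).mul
    ((tendsto_cauchyIntegral hx hg hN hK hH (tendsto_log_neg_one_sub hx.1 hσ)).const_mul
      (1 / (2 * (Real.pi : ℂ) * Complex.I)))
  have hexp := (Complex.continuous_exp.tendsto _).comp hlim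
  have hval : Real.sqrt p = Real.exp (Real.log p / 2) := by
    rw [Real.sqrt_eq_rpow, Real.rpow_def_of_pos hp]; ring_nf
  rw [hval, ← hgp, Complex.ofReal_exp, ← Complex.exp_add]
  have hπ : (Real.pi : ℂ) ≠ 0 := by exact_mod_cast Real.pi_ne_zero
  refine (hexp.congr' ?_).trans_eq ?_
  · filter_upwards [self_mem_nhdsWithin] with z hz
    exact (hD z (hHseg z hz)).symm
  · congr 2
    push_cast
    have hc : 1 / (2 * (Real.pi : ℂ) * Complex.I) = -Complex.I * (1 / (2 * (Real.pi : ℂ))) := by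
      field_simp
      rw [Complex.I_sq, neg_neg]
    have hc2 : (Real.pi : ℂ) * (1 / (2 * (Real.pi : ℂ))) = 1 / 2 := by field_simp
    rw [hc, div_eq_mul_one_div (Real.sqrt (1 - x ^ 2) : ℂ)]
    set c : ℂ := 1 / (2 * (Real.pi : ℂ))
    set w : ℂ := (Real.sqrt (1 - x ^ 2) : ℂ)
    linear_combination (-(Real.pi * c) * (w * g x) * σ ^ 2) * Complex.I_sq +
      (w * g x * (Real.pi * c)) * hσ2 + (w * g x) * hc2

theorem szego_function_boundary_values
    -- `h` is holomorphic in an open neighborhood of `[-1,1]` and strictly positive on `[-1,1]`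
    (h : ℂ → ℂ) (U : Set ℂ) (hU : IsOpen U) (hseg : seg ⊆ U)
    (hhol : DifferentiableOn ℂ h U)
    (hpos : ∀ x ∈ Set.Icc (-1 : ℝ) 1, (h x).im = 0 ∧ 0 < (h x).re)
    -- the branch of `√(z²-1)` holomorphic in `ℂ∖[-1,1]` with `√(z²-1)/z → 1` at `∞`
    (s : ℂ → ℂ)
    (hs : DifferentiableOn ℂ s segᶜ)
    (hs2 : ∀ z ∉ seg, (s z) ^ 2 = z ^ 2 - 1)
    (hsinf : Filter.Tendsto (fun z => s z / z) (Bornology.cobounded ℂ) (nhds 1))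
    -- the Szegő function of `h`, built with `√(1-z²) = -i√(z²-1)`
    (Dh : ℂ → ℂ)
    (hDh : ∀ z ∉ seg, Dh z = Complex.exp ((-Complex.I * s z) *
        ((1 / (2 * (Real.pi : ℂ) * Complex.I)) * ∫ t in (-1 : ℝ)..1,
          ((Real.log (h t).re / Real.sqrt (1 - t ^ 2) : ℝ) : ℂ) / ((t : ℂ) - z)))) :
    ∀ x ∈ Set.Ioo (-1 : ℝ) 1, ∃ V : ℝ,
      -- `V` is the Cauchy principal value of `∫_{-1}^1 (log h(t)/√(1-t²)) dt/(t-x)`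
      Filter.Tendsto (fun ε : ℝ =>
          (∫ t in (-1 : ℝ)..(x - ε), Real.log (h t).re / (Real.sqrt (1 - t ^ 2) * (t - x))) +
          ∫ t in (x + ε)..(1 : ℝ), Real.log (h t).re / (Real.sqrt (1 - t ^ 2) * (t - x)))
        (nhdsWithin 0 (Set.Ioi 0)) (nhds V) ∧
      -- boundary value from the upper half plane
      Filter.Tendsto Dh (nhdsWithin (x : ℂ) {z : ℂ | 0 < z.im})
        (nhds ((Real.sqrt (h x).re : ℂ) * Complex.exp
          (-Complex.I * ((Real.sqrt (1 - x ^ 2) / (2 * Real.pi) * V : ℝ) : ℂ)))) ∧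
      -- boundary value from the lower half plane
      Filter.Tendsto Dh (nhdsWithin (x : ℂ) {z : ℂ | z.im < 0})
        (nhds ((Real.sqrt (h x).re : ℂ) * Complex.exp
          (Complex.I * ((Real.sqrt (1 - x ^ 2) / (2 * Real.pi) * V : ℝ) : ℂ)))) := by
  intro x hx
  have hxU : (x : ℂ) ∈ U :=
    hseg ⟨Complex.ofReal_im x, by simpa using hx.1.le, by simpa using hx.2.le⟩
  have hp : 0 < (h x).re := (hpos x (Ioo_subset_Icc_self hx)).2
  have hg := intervalIntegrable_log_div_sqrt hseg hhol hpos
  obtain ⟨K, N, hN, hK⟩ :=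
    (contDiffAt_log_div_sqrt hU hhol hx hxU hp).exists_lipschitzOnWith
  have hw : 0 < Real.sqrt (1 - x ^ 2) := Real.sqrt_pos.2 (by nlinarith [hx.1, hx.2])
  have hside := fun σ hσ => tendsto_szego_side (σ := σ) hx hσ hg hN hK hp
    (mul_div_cancel₀ _ hw.ne') hs hs2 hsinf hDh
  refine ⟨_, (tendsto_principalValue hx hg hN hK).congr fun ε => by simp only [div_div], ?_, ?_⟩
  · simpa only [one_mul, Complex.ofReal_one] using hside 1 (Or.inl rfl)
  · simpa using hside (-1) (Or.inr rfl)
end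
end

section
/- Define the 2×2 matrix E := (1/(√2·(1-x₀²)^{1/4}))·D_∞^{σ₃}·[[e^{-i·arcsin(x₀)/2}, e^{i·arcsin(x₀)/2}],[-e^{i·arcsin(x₀)/2}, e^{-i·arcsin(x₀)/2}]]·e^{iη·σ₃} and C := ((λ² - γ²/4)·√(1-x₀²)/(2i))·E·[[-1, τ_λ],[-conj(τ_λ), 1]]·E^{-1}. Then, with θ = 2η + ς, the entries of C are: C₁₁ = -( (log c)²/(2π²) + γ²/8 )·x₀ + √( (log c)²/(4π²) + γ²/16 )·sin θ; C₁₂ = i·D_∞²·( (log c)²/(2π²) + γ²/8 - √( (log c)²/(4π²) + γ²/16 )·cos(arcsin x₀ - θ) ); C₂₁ = (i/D_∞²)·( (log c)²/(2π²) + γ²/8 + √( (log c)²/(4π²) + γ²/16 )·cos(arcsin x₀ + θ) ); C₂₂ = ( (log c)²/(2π²) + γ²/8 )·x₀ - √( (log c)²/(4π²) + γ²/16 )·sin θ. -/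
noncomputable section

open Complex

/-- For `Γ(z) ≠ 0`, the quotient `Γ(z̄)/Γ(z+1)` has modulus `1/|z|` and phase
`-2 arg Γ(z) - arg z`. -/
lemma Gamma_conj_div_Gamma_add_one {z : ℂ} (hz : z ≠ 0) (hG : Gamma z ≠ 0) :
    Gamma ((starRingEnd ℂ) z) / Gamma (z + 1) =
      exp (((-2 * arg (Gamma z) - arg z : ℝ) : ℂ) * I) / (‖z‖ : ℂ) := by
  have hz' : (‖z‖ : ℂ) ≠ 0 := by simpa using hz
  have hG' : (‖Gamma z‖ : ℂ) ≠ 0 := by simpa using hG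
  have hconj : (starRingEnd ℂ) (Gamma z) = ‖Gamma z‖ * exp (-(arg (Gamma z) * I)) := by
    conv_lhs => rw [← norm_mul_exp_arg_mul_I (Gamma z), map_mul, conj_ofReal, ← exp_conj]
    simp
  have hexp : exp (((-2 * arg (Gamma z) - arg z : ℝ) : ℂ) * I) =
      exp (-(arg (Gamma z) * I)) * (exp (arg (Gamma z) * I))⁻¹ * (exp (arg z * I))⁻¹ := by
    rw [← exp_neg, ← exp_neg, ← exp_add, ← exp_add]
    congr 1
    push_cast
    ring
  have hprod : z * Gamma z =
      (‖z‖ * exp (arg z * I)) * (‖Gamma z‖ * exp (arg (Gamma z) * I)) := by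
    rw [norm_mul_exp_arg_mul_I, norm_mul_exp_arg_mul_I]
  rw [Gamma_conj, Gamma_add_one z hz, hconj, hexp, hprod]
  have h1 := exp_ne_zero (arg z * I)
  have h2 := exp_ne_zero (arg (Gamma z) * I)
  field_simp

/-- Conjugation of `[[-1, τ], [-τ', 1]]` by a matrix of determinant one. -/
lemma conj_mul_inv_of_det_eq_one (a b c d τ τ' : ℂ) (h : a * d - b * c = 1) :
    !![a, b; c, d] * !![-1, τ; -τ', 1] * !![a, b; c, d]⁻¹ =
      !![-a * d - b * c - b * d * τ' - a * c * τ, 2 * a * b + b ^ 2 * τ' + a ^ 2 * τ;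
         -2 * c * d - d ^ 2 * τ' - c ^ 2 * τ, a * d + b * c + b * d * τ' + a * c * τ] := by
  rw [Matrix.inv_def, Matrix.adjugate_fin_two_of, Matrix.det_fin_two_of, h]
  ext i j
  fin_cases i <;> fin_cases j <;> simp [Matrix.mul_apply, Fin.sum_univ_two] <;> ring

theorem residue_matrix_entries
    (x₀ γ c : ℝ) (hx₀ : x₀ ∈ Set.Ioo (-1 : ℝ) 1)
    (hγ : -1 < γ) (hc : 0 < c) (hγc : ¬(γ = 0 ∧ c = 1))
    -- `λ = i·log c/π`
    (lam : ℂ) (hlam : lam = Complex.I * ((Real.log c / Real.pi : ℝ) : ℂ))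
    -- `η` real, `D_∞ > 0`
    (η Dinf : ℝ) (hDinf : 0 < Dinf)
    -- `τ_λ = -Γ(γ/2-λ)/Γ(γ/2+λ+1)` and `ς = -2·arg Γ(γ/2+λ) - arg(γ/2+λ)`
    (τ : ℂ)
    (hτ : τ = -(Complex.Gamma (((γ / 2 : ℝ) : ℂ) - lam) /
        Complex.Gamma (((γ / 2 : ℝ) : ℂ) + lam + 1)))
    (ς : ℝ)
    (hς : ς = -2 * Complex.arg (Complex.Gamma (((γ / 2 : ℝ) : ℂ) + lam))
        - Complex.arg (((γ / 2 : ℝ) : ℂ) + lam))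
    -- the matrices `E` and `C`
    (E C : Matrix (Fin 2) (Fin 2) ℂ)
    (hE : E = (((1 / (Real.sqrt 2 * (1 - x₀ ^ 2) ^ ((1 : ℝ) / 4)) : ℝ) : ℂ)) •
      (Matrix.diagonal ![(Dinf : ℂ), (Dinf : ℂ)⁻¹] *
       !![Complex.exp (-(Complex.I * ((Real.arcsin x₀ / 2 : ℝ) : ℂ))),
          Complex.exp (Complex.I * ((Real.arcsin x₀ / 2 : ℝ) : ℂ));
          -Complex.exp (Complex.I * ((Real.arcsin x₀ / 2 : ℝ) : ℂ)),
          Complex.exp (-(Complex.I * ((Real.arcsin x₀ / 2 : ℝ) : ℂ)))] *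
       Matrix.diagonal ![Complex.exp (Complex.I * (η : ℂ)),
          Complex.exp (-(Complex.I * (η : ℂ)))]))
    (hC : C = ((lam ^ 2 - ((γ ^ 2 / 4 : ℝ) : ℂ)) *
        ((Real.sqrt (1 - x₀ ^ 2) : ℝ) : ℂ) / (2 * Complex.I)) •
      (E * !![-1, τ; -(starRingEnd ℂ) τ, 1] * E⁻¹))
    -- `θ = 2η + ς`
    (θ : ℝ) (hθ : θ = 2 * η + ς) :
    C 0 0 = ((-((Real.log c) ^ 2 / (2 * Real.pi ^ 2) + γ ^ 2 / 8) * x₀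
        + Real.sqrt ((Real.log c) ^ 2 / (4 * Real.pi ^ 2) + γ ^ 2 / 16) * Real.sin θ : ℝ) : ℂ) ∧
    C 0 1 = Complex.I * ((Dinf ^ 2 : ℝ) : ℂ) *
      ((((Real.log c) ^ 2 / (2 * Real.pi ^ 2) + γ ^ 2 / 8
        - Real.sqrt ((Real.log c) ^ 2 / (4 * Real.pi ^ 2) + γ ^ 2 / 16) *
          Real.cos (Real.arcsin x₀ - θ) : ℝ)) : ℂ) ∧
    C 1 0 = Complex.I / ((Dinf ^ 2 : ℝ) : ℂ) *
      ((((Real.log c) ^ 2 / (2 * Real.pi ^ 2) + γ ^ 2 / 8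
        + Real.sqrt ((Real.log c) ^ 2 / (4 * Real.pi ^ 2) + γ ^ 2 / 16) *
          Real.cos (Real.arcsin x₀ + θ) : ℝ)) : ℂ) ∧
    C 1 1 = ((((Real.log c) ^ 2 / (2 * Real.pi ^ 2) + γ ^ 2 / 8) * x₀
        - Real.sqrt ((Real.log c) ^ 2 / (4 * Real.pi ^ 2) + γ ^ 2 / 16) * Real.sin θ : ℝ) : ℂ) := by
  set α := Real.arcsin x₀
  set z : ℂ := ((γ / 2 : ℝ) : ℂ) + lam with hzdef
  set ρ : ℝ := ‖z‖ with hρdef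
  have hzre : z.re = γ / 2 := by simp [hzdef, hlam, -ofReal_div]
  have hzim : z.im = Real.log c / Real.pi := by simp [hzdef, hlam, -ofReal_div]
  have hz : z ≠ 0 := by
    intro h
    have h1 : γ = 0 := by
      have := hzre.symm.trans (congrArg re h)
      simpa using this
    have h2 : Real.log c / Real.pi = 0 := hzim.symm.trans (congrArg im h)
    have h3 : Real.log c = 0 := by simpa [Real.pi_ne_zero] using h2
    exact hγc ⟨h1, Real.eq_one_of_pos_of_log_eq_zero hc h3⟩
  have hG : Gamma z ≠ 0 := by
    refine Gamma_ne_zero fun m hm => ?_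
    have hre : γ / 2 = -m := by rw [← hzre, hm]; simp
    have hm0 : m = 0 := by
      have : (m : ℝ) < 1 := by linarith
      exact_mod_cast Nat.lt_one_iff.mp (by exact_mod_cast this)
    exact hz (by simpa [hm0] using hm)
  have hρ : 0 < ρ := norm_pos_iff.mpr hz
  have hρsq : ρ ^ 2 = Real.log c ^ 2 / Real.pi ^ 2 + γ ^ 2 / 4 := by
    rw [hρdef, ← normSq_eq_norm_sq, normSq_apply, hzre, hzim]
    ring
  have hA : Real.log c ^ 2 / (2 * Real.pi ^ 2) + γ ^ 2 / 8 = ρ ^ 2 / 2 := by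
    rw [hρsq]; field_simp; ring
  have hB : Real.sqrt (Real.log c ^ 2 / (4 * Real.pi ^ 2) + γ ^ 2 / 16) = ρ / 2 := by
    rw [show Real.log c ^ 2 / (4 * Real.pi ^ 2) + γ ^ 2 / 16 = (ρ / 2) ^ 2 by
      rw [div_pow, hρsq]; field_simp; ring]
    exact Real.sqrt_sq (by positivity)
  have hlamsq : lam ^ 2 - ((γ ^ 2 / 4 : ℝ) : ℂ) = -(ρ : ℂ) ^ 2 := by
    rw [← ofReal_pow, hρsq, hlam, mul_pow, I_sq]
    push_cast
    ring
  have hτ' : τ = -(exp (I * ς) / ρ) := by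
    have hconj : ((γ / 2 : ℝ) : ℂ) - lam = (starRingEnd ℂ) z := by
      simp [hzdef, hlam, sub_eq_add_neg, -ofReal_div]
    rw [hτ, hconj, Gamma_conj_div_Gamma_add_one hz hG, ← hς, mul_comm I]
  have hτc : (starRingEnd ℂ) τ = -((exp (I * ς))⁻¹ / ρ) := by
    rw [hτ', ← exp_neg]
    simp [← exp_conj]
  set s : ℝ := Real.sqrt (1 - x₀ ^ 2) with hs
  have hpos : 0 < 1 - x₀ ^ 2 := by nlinarith [hx₀.1, hx₀.2]
  have hs0 : 0 < s := Real.sqrt_pos.mpr hpos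
  set k : ℝ := 1 / (Real.sqrt 2 * (1 - x₀ ^ 2) ^ ((1 : ℝ) / 4)) with hk
  have hksq : k ^ 2 * (2 * s) = 1 := by
    have h4 : ((1 - x₀ ^ 2) ^ ((1 : ℝ) / 4)) ^ 2 = s := by
      rw [← Real.rpow_natCast, ← Real.rpow_mul hpos.le, hs, Real.sqrt_eq_rpow]
      norm_num
    rw [hk, div_pow, mul_pow, h4, Real.sq_sqrt (by norm_num)]
    field_simp
  have hcos : Real.cos α = s := Real.cos_arcsin x₀
  have hsin : x₀ = Real.sin α := (Real.sin_arcsin hx₀.1.le hx₀.2.le).symm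
  set U := exp (I * ((α / 2 : ℝ) : ℂ)) with hU
  set V := exp (I * (η : ℂ)) with hV
  set W := exp (I * (ς : ℂ)) with hW
  have hU0 : U ≠ 0 := exp_ne_zero _
  have hV0 : V ≠ 0 := exp_ne_zero _
  have hW0 : W ≠ 0 := exp_ne_zero _
  have hUα : exp (α * I) = U ^ 2 := by
    rw [hU, ← exp_nat_mul]; congr 1; push_cast; ring
  have hVθ : exp (θ * I) = V ^ 2 * W := by
    rw [hV, hW, ← exp_nat_mul, ← exp_add, hθ]; congr 1; push_cast; ring
  have hsC : (s : ℂ) = (U ^ 2 + (U ^ 2)⁻¹) / 2 := by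
    rw [← hcos, ofReal_cos, Complex.cos, neg_mul, exp_neg, hUα]
  have hxC : (x₀ : ℂ) = ((U ^ 2)⁻¹ - U ^ 2) * I / 2 := by
    rw [hsin, ofReal_sin, Complex.sin, neg_mul, exp_neg, hUα]
  have hsinθ : Complex.sin θ = ((V ^ 2 * W)⁻¹ - V ^ 2 * W) * I / 2 := by
    rw [Complex.sin, neg_mul, exp_neg, hVθ]
  have hcosm : Complex.cos (α - θ) = (U ^ 2 * (V ^ 2 * W)⁻¹ + (U ^ 2)⁻¹ * (V ^ 2 * W)) / 2 := by
    rw [Complex.cos, neg_mul, exp_neg, sub_mul, exp_sub, hUα, hVθ]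
    field_simp
  have hcosp : Complex.cos (α + θ) = (U ^ 2 * (V ^ 2 * W) + (U ^ 2)⁻¹ * (V ^ 2 * W)⁻¹) / 2 := by
    rw [Complex.cos, neg_mul, exp_neg, add_mul, exp_add, hUα, hVθ, mul_inv]
  have hρ0 : (ρ : ℂ) ≠ 0 := by exact_mod_cast hρ.ne'
  have hD0 : (Dinf : ℂ) ≠ 0 := by exact_mod_cast hDinf.ne'
  have hkC : (k : ℂ) ^ 2 * (2 * s) = 1 := by exact_mod_cast hksq
  have hE' : E = !![k * Dinf * U⁻¹ * V, k * Dinf * U * V⁻¹;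
      -(k * (Dinf : ℂ)⁻¹ * U * V), k * (Dinf : ℂ)⁻¹ * U⁻¹ * V⁻¹] := by
    rw [hE, exp_neg, exp_neg, ← hU, ← hV]
    ext i j
    fin_cases i <;> fin_cases j <;>
      simp [Matrix.mul_apply, Matrix.diagonal] <;> ring
  have hdet : (k * Dinf * U⁻¹ * V) * (k * (Dinf : ℂ)⁻¹ * U⁻¹ * V⁻¹) -
      (k * Dinf * U * V⁻¹) * (-(k * (Dinf : ℂ)⁻¹ * U * V)) = 1 := by
    rw [← hkC, hsC]
    field_simp
    ring
  have hscal : (-(ρ : ℂ) ^ 2) * s / (2 * I) * k ^ 2 = ρ ^ 2 * I / 4 := by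
    rw [div_mul_eq_mul_div, div_eq_iff (by simp)]
    linear_combination (-(ρ : ℂ) ^ 2 / 2) * hkC - (ρ : ℂ) ^ 2 / 2 * I_sq
  rw [hlamsq, hE', conj_mul_inv_of_det_eq_one _ _ _ _ _ _ hdet, hτc, hτ'] at hC
  have hentry (X : ℂ) :
      (-(ρ : ℂ) ^ 2) * s / (2 * I) * (k ^ 2 * X) = ρ ^ 2 * I / 4 * X := by
    rw [← mul_assoc, hscal]
  rw [hA, hB, hC]
  push_cast
  rw [hxC, hsinθ, hcosm, hcosp]
  simp only [Matrix.smul_apply, Matrix.of_apply, Matrix.cons_val_zero, Matrix.cons_val_one,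
    Matrix.cons_val', Matrix.cons_val_fin_one, smul_eq_mul]
  refine ⟨?_, ?_, ?_, ?_⟩
  · trans ρ ^ 2 * I / 4 * (U ^ 2 - (U ^ 2)⁻¹ + (V ^ 2 * W)⁻¹ / ρ - V ^ 2 * W / ρ)
    · rw [← hentry]; congr 1; field_simp; ring
    · field_simp; ring
  · trans ρ ^ 2 * I / 4 *
        (Dinf ^ 2 * (2 - U ^ 2 * (V ^ 2 * W)⁻¹ / ρ - (U ^ 2)⁻¹ * (V ^ 2 * W) / ρ))
    · rw [← hentry]; congr 1; field_simp; ring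
    · field_simp; ring
  · trans ρ ^ 2 * I / 4 *
        ((2 + U ^ 2 * (V ^ 2 * W) / ρ + (U ^ 2)⁻¹ * (V ^ 2 * W)⁻¹ / ρ) / Dinf ^ 2)
    · rw [← hentry]; congr 1; field_simp; ring
    · field_simp; ring
  · trans ρ ^ 2 * I / 4 * ((U ^ 2)⁻¹ - U ^ 2 + V ^ 2 * W / ρ - (V ^ 2 * W)⁻¹ / ρ)
    · rw [← hentry]; congr 1; field_simp; ring
    · field_simp; ring
end
end
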